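/- For any h ∈ C^∞(R^4) and any R > 1, one has the pointwise bound ||h||_{L^∞(R ≤ |x| ≤ R+1)} ≤ C R^{-3/2} Σ_{|α|≤2, j≤1} ||Ω^α ∇_x^j h||_{L^2(R-1 ≤ |x| ≤ R+2)}, where the Ω^α range over products of at most 2 of the rotation vector fields Ω_{ij} = x_i ∂_j − x_j ∂_i (1 ≤ i < j ≤ 4), and ∇_x^j denotes j spatial derivatives. -/

import Mathlib

open MeasureTheory Real

/-- Partial derivative `∂_i f` on `ℝ⁴`. -/
noncomputable def pd (i : Fin 4) (f : EuclideanSpace ℝ (Fin 4) → ℝ) :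
    EuclideanSpace ℝ (Fin 4) → ℝ :=
  fun x => fderiv ℝ f x (EuclideanSpace.single i 1)

/-- Rotation vector field `Ω_{ij} f = x_i ∂_j f − x_j ∂_i f` on `ℝ⁴`. -/
noncomputable def rot (i j : Fin 4) (f : EuclideanSpace ℝ (Fin 4) → ℝ) :
    EuclideanSpace ℝ (Fin 4) → ℝ :=
  fun x => x i * pd j f x - x j * pd i f x

/-- Ordered pairs `1 ≤ i < j ≤ 4` indexing the rotation fields. -/
noncomputable def rotPairs : Finset (Fin 4 × Fin 4) :=
  Finset.univ.filter (fun p => p.1 < p.2)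

/-- `L²` norm of `f` over the annulus `a ≤ |x| ≤ b`. -/
noncomputable def annL2 (f : EuclideanSpace ℝ (Fin 4) → ℝ) (a b : ℝ) : ℝ :=
  Real.sqrt (∫ x in {x : EuclideanSpace ℝ (Fin 4) | a ≤ ‖x‖ ∧ ‖x‖ ≤ b}, (f x) ^ 2)

/-- `Σ_{|α| ≤ 2} ‖Ω^α f‖_{L²(a ≤ |x| ≤ b)}`: sum over products of at most two
rotation fields applied to `f`. -/
noncomputable def rotSum2 (f : EuclideanSpace ℝ (Fin 4) → ℝ) (a b : ℝ) : ℝ :=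
  annL2 f a b + (∑ p ∈ rotPairs, annL2 (rot p.1 p.2 f) a b) +
    ∑ p ∈ rotPairs, ∑ q ∈ rotPairs, annL2 (rot q.1 q.2 (rot p.1 p.2 f)) a b

open Set Metric Module
open scoped ENNReal

theorem lintegral_eq_lintegral_sphere_Ioi {V : Type*} [NormedAddCommGroup V] [NormedSpace ℝ V]
    [FiniteDimensional ℝ V] [Nontrivial V] [MeasurableSpace V] [BorelSpace V]
    (μ : Measure V) [μ.IsAddHaarMeasure] {F : V → ℝ≥0∞} (hF : Measurable F) :
    ∫⁻ y, F y ∂μ = ∫⁻ ω : sphere (0 : V) 1, (∫⁻ s in Ioi (0 : ℝ),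
      ENNReal.ofReal (s ^ (finrank ℝ V - 1)) * F (s • (ω : V))) ∂μ.toSphere := by
  have hmp := μ.measurePreserving_homeomorphUnitSphereProd
  have hG : Measurable fun p : sphere (0 : V) 1 × Ioi (0 : ℝ) => F ((p.2 : ℝ) • (p.1 : V)) :=
    hF.comp (by fun_prop)
  calc ∫⁻ y, F y ∂μ = ∫⁻ y in ({0}ᶜ : Set V), F y ∂μ := by
        rw [restrict_compl_singleton]
    _ = ∫⁻ y : ({0}ᶜ : Set V), F y ∂(μ.comap (↑)) :=
        (lintegral_subtype_comap (measurableSet_singleton _).compl _).symm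
    _ = ∫⁻ p : sphere (0 : V) 1 × Ioi (0 : ℝ), F ((p.2 : ℝ) • (p.1 : V))
          ∂(μ.toSphere.prod (.volumeIoiPow (finrank ℝ V - 1))) := by
        rw [← hmp.lintegral_comp hG]
        refine lintegral_congr fun y => ?_
        congr 1
        exact congrArg Subtype.val ((homeomorphUnitSphereProd V).symm_apply_apply y).symm
    _ = _ := by
        rw [lintegral_prod _ hG.aemeasurable]
        refine lintegral_congr fun ω => ?_
        have hω : Measurable fun s : ℝ => F (s • (ω : V)) := hF.comp (by fun_prop)
        refine (lintegral_withDensity_eq_lintegral_mul _ (by fun_prop)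
          (hω.comp measurable_subtype_coe)).trans ?_
        exact lintegral_subtype_comap measurableSet_Ioi
          (fun s : ℝ => ENNReal.ofReal (s ^ (finrank ℝ V - 1)) * F (s • (ω : V)))

theorem exists_linearIsometry_orthogonal_lintegral_eq {n : ℕ}
    {e : EuclideanSpace ℝ (Fin (n + 1))} (he : ‖e‖ = 1) :
    ∃ L : EuclideanSpace ℝ (Fin n) →ₗᵢ[ℝ] EuclideanSpace ℝ (Fin (n + 1)),
      (∀ y, inner ℝ e (L y) = 0) ∧ ∀ F : EuclideanSpace ℝ (Fin (n + 1)) → ℝ≥0∞, Measurable F →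
        ∫⁻ x, F x = ∫⁻ y, ∫⁻ t : ℝ, F (t • e + L y) := by
  obtain ⟨b, hb⟩ := Orthonormal.exists_orthonormalBasis_extension_of_card_eq (𝕜 := ℝ)
    (E := EuclideanSpace ℝ (Fin (n + 1))) (ι := Fin (n + 1)) (by simp) (v := fun _ => e) (s := {0})
    (by
      rw [orthonormal_iff_ite]
      rintro ⟨i, hi⟩ ⟨j, hj⟩
      simp only [mem_singleton_iff] at hi hj
      subst hi hj
      simp [he])
  have hb0 : b 0 = e := hb 0 rfl
  let L₀ : EuclideanSpace ℝ (Fin n) →ₗ[ℝ] EuclideanSpace ℝ (Fin (n + 1)) :=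
    { toFun := fun y => WithLp.toLp 2 (Fin.cons 0 (fun i => y i))
      map_add' := fun x y => by ext i; refine Fin.cases ?_ (fun j => ?_) i <;> simp
      map_smul' := fun c y => by ext i; refine Fin.cases ?_ (fun j => ?_) i <;> simp }
  let L₁ : EuclideanSpace ℝ (Fin n) →ₗᵢ[ℝ] EuclideanSpace ℝ (Fin (n + 1)) :=
    ⟨L₀, fun y => by simp [L₀, EuclideanSpace.norm_eq, Fin.sum_univ_succ]⟩
  have hsplit : ∀ (t : ℝ) (y : EuclideanSpace ℝ (Fin n)),
      b.repr.symm (WithLp.toLp 2 (Fin.cons t (fun i => y i))) =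
        t • e + b.repr.symm (L₁ y) := fun t y => by
    rw [← hb0, ← b.repr_symm_single, ← map_smul, ← map_add]
    congr 1
    ext i; refine Fin.cases ?_ (fun j => ?_) i <;> simp [L₁, L₀]
  refine ⟨b.repr.symm.toLinearIsometry.comp L₁, fun y => ?_, fun F hF => ?_⟩
  · rw [← hb0, ← b.repr.inner_map_map]
    simp [L₁, L₀, b.repr_self, EuclideanSpace.inner_single_left]
  · have hF' : Measurable fun z => F (b.repr.symm z) := hF.comp b.repr.symm.continuous.measurable
    have h1 : Measurable fun p : ℝ × (Fin n → ℝ) =>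
        F (b.repr.symm (WithLp.toLp 2 (Fin.cons p.1 p.2))) := by
      refine hF'.comp ?_
      have : Measurable fun p : ℝ × (Fin n → ℝ) => (Fin.cons p.1 p.2 : Fin (n + 1) → ℝ) := by
        refine measurable_pi_iff.2 fun i => ?_
        refine Fin.cases ?_ (fun j => ?_) i <;> simp <;> fun_prop
      fun_prop
    calc ∫⁻ x, F x = ∫⁻ z, F (b.repr.symm z) :=
          (b.repr.symm.measurePreserving.lintegral_comp hF).symm
      _ = ∫⁻ w : Fin (n + 1) → ℝ, F (b.repr.symm (WithLp.toLp 2 w)) :=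
          ((PiLp.volume_preserving_toLp (Fin (n + 1))).lintegral_comp hF').symm
      _ = ∫⁻ p : ℝ × (Fin n → ℝ), F (b.repr.symm (WithLp.toLp 2 (Fin.cons p.1 p.2))) := by
          rw [← ((volume_preserving_piFinSuccAbove (fun _ : Fin (n + 1) => ℝ) 0).symm
            _).lintegral_comp_emb (MeasurableEquiv.measurableEmbedding _)]
          refine lintegral_congr fun p => ?_
          simp [MeasurableEquiv.piFinSuccAbove, Fin.consEquiv]
      _ = ∫⁻ y : Fin n → ℝ, ∫⁻ t : ℝ, F (b.repr.symm (WithLp.toLp 2 (Fin.cons t y))) :=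
          lintegral_prod_symm _ h1.aemeasurable
      _ = ∫⁻ y : EuclideanSpace ℝ (Fin n), ∫⁻ t : ℝ,
            F (b.repr.symm (WithLp.toLp 2 (Fin.cons t (fun i => y i)))) :=
          (PiLp.volume_preserving_toLp (Fin n)).lintegral_comp_emb
            (MeasurableEquiv.toLp 2 _).measurableEmbedding (fun y => ∫⁻ t : ℝ,
            F (b.repr.symm (WithLp.toLp 2 (Fin.cons t (fun i => y i)))))
      _ = _ := by simp_rw [hsplit]; rfl

theorem setLIntegral_geodesic_polar {e : EuclideanSpace ℝ (Fin 4)} (he : ‖e‖ = 1) :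
    ∃ L : EuclideanSpace ℝ (Fin 3) →ₗᵢ[ℝ] EuclideanSpace ℝ (Fin 4), (∀ y, inner ℝ e (L y) = 0) ∧
      ∀ F : EuclideanSpace ℝ (Fin 4) → ℝ≥0∞, Measurable F →
        ∫⁻ ω : sphere (0 : EuclideanSpace ℝ (Fin 3)) 1, (∫⁻ p in Ioi (0 : ℝ) ×ˢ Ioo 0 π,
          ENNReal.ofReal (p.1 ^ 3 * sin p.2 ^ 2) *
            F (p.1 • (cos p.2 • e + sin p.2 • L ω))) ∂(Measure.toSphere volume) ≤ ∫⁻ x, F x := by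
  obtain ⟨L, hL, hF⟩ := exists_linearIsometry_orthogonal_lintegral_eq he
  refine ⟨L, hL, fun F hFm => ?_⟩
  have hm : Measurable fun q : EuclideanSpace ℝ (Fin 3) × ℝ => F (q.2 • e + L q.1) :=
    hFm.comp (Continuous.measurable (by have := L.continuous; fun_prop))
  rw [hF F hFm, lintegral_eq_lintegral_sphere_Ioi volume hm.lintegral_prod_right']
  refine lintegral_mono fun ω => ?_
  let H : ℝ × ℝ → ℝ≥0∞ := fun q => (Ioi (0 : ℝ)).indicator
    (fun s => ENNReal.ofReal (s ^ 2) * F (q.1 • e + L (s • (ω : EuclideanSpace ℝ (Fin 3))))) q.2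
  have hHm : Measurable H := by
    have h1 : Measurable fun q : ℝ × ℝ => ENNReal.ofReal (q.2 ^ 2) *
        F (q.1 • e + L (q.2 • (ω : EuclideanSpace ℝ (Fin 3)))) := by
      refine Measurable.mul (by fun_prop) (hFm.comp (Continuous.measurable ?_))
      have := L.continuous
      fun_prop
    exact h1.indicator (measurable_snd measurableSet_Ioi)
  calc ∫⁻ p in Ioi (0 : ℝ) ×ˢ Ioo 0 π, ENNReal.ofReal (p.1 ^ 3 * sin p.2 ^ 2) *
            F (p.1 • (cos p.2 • e + sin p.2 • L ω))
      = ∫⁻ p in Ioi (0 : ℝ) ×ˢ Ioo 0 π, ENNReal.ofReal p.1 • H (polarCoord.symm p) := by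
        refine setLIntegral_congr_fun (measurableSet_Ioi.prod measurableSet_Ioo) ?_
        rintro ⟨r, θ⟩ ⟨hr, hθ⟩
        simp only [mem_Ioi, mem_Ioo] at hr hθ
        have hs : 0 < r * sin θ := mul_pos hr (sin_pos_of_pos_of_lt_pi hθ.1 hθ.2)
        simp only [H, polarCoord_symm_apply, smul_eq_mul]
        rw [indicator_of_mem (mem_Ioi.2 hs), ← mul_assoc, ← ENNReal.ofReal_mul hr.le, map_smul]
        congr 2
        · ring
        · simp only [smul_add, smul_smul]
    _ ≤ ∫⁻ p in polarCoord.target, ENNReal.ofReal p.1 • H (polarCoord.symm p) := by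
        refine lintegral_mono_set ?_
        rw [polarCoord_target]
        exact prod_mono le_rfl (Ioo_subset_Ioo_left (by linarith [pi_pos]))
    _ = ∫⁻ p, H p := lintegral_comp_polarCoord_symm H
    _ = ∫⁻ s : ℝ, ∫⁻ t : ℝ, H (t, s) := lintegral_prod_symm _ hHm.aemeasurable
    _ = ∫⁻ s in Ioi (0 : ℝ), ENNReal.ofReal (s ^ (finrank ℝ (EuclideanSpace ℝ (Fin 3)) - 1)) *
          ∫⁻ t : ℝ, F (t • e + L (s • (ω : EuclideanSpace ℝ (Fin 3)))) := by
        rw [← lintegral_indicator measurableSet_Ioi]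
        refine lintegral_congr fun s => ?_
        by_cases hs : s ∈ Ioi (0 : ℝ)
        · simp only [H, indicator_of_mem hs, finrank_euclideanSpace_fin]
          rw [lintegral_const_mul' _ _ ENNReal.ofReal_ne_top]
        · simp [H, indicator_of_notMem hs]

theorem sq_intervalIntegral_zero_one_le {φ : ℝ → ℝ} (hφ : Continuous φ) :
    (∫ t in (0 : ℝ)..1, φ t) ^ 2 ≤ ∫ t in (0 : ℝ)..1, φ t ^ 2 := by
  set m := ∫ t in (0 : ℝ)..1, φ t with hm
  have h0 : 0 ≤ ∫ t in (0 : ℝ)..1, (φ t - m) ^ 2 :=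
    intervalIntegral.integral_nonneg zero_le_one fun t _ => sq_nonneg _
  have h1 : ∫ t in (0 : ℝ)..1, (φ t - m) ^ 2 = (∫ t in (0 : ℝ)..1, φ t ^ 2) - m ^ 2 := by
    have : ∀ t, (φ t - m) ^ 2 = φ t ^ 2 - 2 * m * φ t + m ^ 2 := fun t => by ring
    simp_rw [this]
    rw [intervalIntegral.integral_add, intervalIntegral.integral_sub,
      intervalIntegral.integral_const_mul, ← hm]
    · simp; ring
    all_goals exact Continuous.intervalIntegrable (by fun_prop) _ _
  linarith

theorem sq_le_integral_sq_add_sq_deriv {f f₁ : ℝ → ℝ} (h : ∀ t, HasDerivAt f (f₁ t) t)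
    (hf₁ : Continuous f₁) : f 0 ^ 2 ≤ 2 * ∫ t in (0 : ℝ)..1, (f t ^ 2 + f₁ t ^ 2) := by
  have hf : Continuous f := continuous_iff_continuousAt.2 fun t => (h t).continuousAt
  have key : ∫ t in (0 : ℝ)..1, (f t - (1 - t) * f₁ t) = f 0 := by
    have := intervalIntegral.integral_eq_sub_of_hasDerivAt (a := 0) (b := 1)
      (f := fun t => -((1 - t) * f t)) (f' := fun t => f t - (1 - t) * f₁ t)
      (fun t _ => by
        convert! (((hasDerivAt_id t).const_sub 1).mul (h t)).neg using 1
        simp; ring) (Continuous.intervalIntegrable (by fun_prop) _ _)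
    simpa using this
  rw [← key, ← intervalIntegral.integral_const_mul]
  refine (sq_intervalIntegral_zero_one_le (by fun_prop)).trans ?_
  refine intervalIntegral.integral_mono_on zero_le_one
    (Continuous.intervalIntegrable (by fun_prop) _ _)
    (Continuous.intervalIntegrable (by fun_prop) _ _) fun t ht => ?_
  have h1 : (1 - t) ^ 2 ≤ 1 := by nlinarith [ht.1, ht.2]
  nlinarith [sq_nonneg (f t + (1 - t) * f₁ t), mul_le_mul_of_nonneg_right h1 (sq_nonneg (f₁ t))]

theorem sq_le_integral_weighted_sq_deriv_two {f f₁ f₂ : ℝ → ℝ}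
    (h : ∀ t, HasDerivAt f (f₁ t) t) (h₁ : ∀ t, HasDerivAt f₁ (f₂ t) t) (hf₂ : Continuous f₂) :
    f 0 ^ 2 ≤ 21 * ∫ t in (0 : ℝ)..1, t ^ 2 * (f t ^ 2 + f₁ t ^ 2 + f₂ t ^ 2) := by
  have hf : Continuous f := continuous_iff_continuousAt.2 fun t => (h t).continuousAt
  have hf₁ : Continuous f₁ := continuous_iff_continuousAt.2 fun t => (h₁ t).continuousAt
  have key : ∫ t in (0 : ℝ)..1, t * (2 * f t - 4 * (1 - t) * f₁ t + (1 - t) ^ 2 * f₂ t)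
      = f 0 := by
    have := intervalIntegral.integral_eq_sub_of_hasDerivAt (a := 0) (b := 1)
      (f := fun t => t * (1 - t) ^ 2 * f₁ t - (1 - t ^ 2) * f t)
      (f' := fun t => t * (2 * f t - 4 * (1 - t) * f₁ t + (1 - t) ^ 2 * f₂ t))
      (fun t _ => by
        have hs : HasDerivAt (fun t : ℝ => 1 - t) (-1) t := by
          simpa using (hasDerivAt_id t).const_sub 1
        convert! (((hasDerivAt_id t).mul (hs.pow 2)).mul (h₁ t)).sub
          (((hasDerivAt_pow 2 t).const_sub 1).mul (h t)) using 1
        simp; ring) (Continuous.intervalIntegrable (by fun_prop) _ _)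
    simpa using this
  rw [← key, ← intervalIntegral.integral_const_mul]
  refine (sq_intervalIntegral_zero_one_le (by fun_prop)).trans ?_
  refine intervalIntegral.integral_mono_on zero_le_one
    (Continuous.intervalIntegrable (by fun_prop) _ _)
    (Continuous.intervalIntegrable (by fun_prop) _ _) fun t ht => ?_
  set s := 1 - t with hs
  have h1 : s ^ 2 ≤ 1 := by nlinarith [ht.1, ht.2]
  have h2 : (s ^ 2) ^ 2 ≤ 1 := by nlinarith [sq_nonneg s]
  have h3 : (2 * f t - 4 * s * f₁ t + s ^ 2 * f₂ t) ^ 2 ≤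
      (4 + 16 + 1) * (f t ^ 2 + (s * f₁ t) ^ 2 + (s ^ 2 * f₂ t) ^ 2) := by
    nlinarith [sq_nonneg (4 * f t + 2 * (s * f₁ t)), sq_nonneg (f t - 2 * (s ^ 2 * f₂ t)),
      sq_nonneg (s * f₁ t + 4 * (s ^ 2 * f₂ t))]
  have h4 : (s * f₁ t) ^ 2 ≤ f₁ t ^ 2 := by nlinarith [sq_nonneg (f₁ t)]
  have h5 : (s ^ 2 * f₂ t) ^ 2 ≤ f₂ t ^ 2 := by nlinarith [sq_nonneg (f₂ t)]
  rw [mul_pow]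
  nlinarith [sq_nonneg t, mul_le_mul_of_nonneg_left
    (h3.trans (by linarith : _ ≤ 21 * (f t ^ 2 + f₁ t ^ 2 + f₂ t ^ 2))) (sq_nonneg t)]

theorem ContDiff.pd {f : EuclideanSpace ℝ (Fin 4) → ℝ} (hf : ContDiff ℝ (⊤ : ℕ∞) f) (i : Fin 4) :
    ContDiff ℝ (⊤ : ℕ∞) (pd i f) :=
  (hf.fderiv_right (by simp)).clm_apply contDiff_const

theorem ContDiff.rot {f : EuclideanSpace ℝ (Fin 4) → ℝ} (hf : ContDiff ℝ (⊤ : ℕ∞) f)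
    (i j : Fin 4) : ContDiff ℝ (⊤ : ℕ∞) (rot i j f) := by
  have hi := hf.pd i
  have hj := hf.pd j
  have hx : ∀ k : Fin 4, ContDiff ℝ (⊤ : ℕ∞) fun x : EuclideanSpace ℝ (Fin 4) => x k :=
    fun k => (EuclideanSpace.proj k : EuclideanSpace ℝ (Fin 4) →L[ℝ] ℝ).contDiff
  exact ((hx i).mul hj).sub ((hx j).mul hi)

theorem fderiv_apply_eq_sum_pd (f : EuclideanSpace ℝ (Fin 4) → ℝ) (x v : EuclideanSpace ℝ (Fin 4)) :
    fderiv ℝ f x v = ∑ i, v i * pd i f x := by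
  conv_lhs => rw [← (EuclideanSpace.basisFun (Fin 4) ℝ).sum_repr v]
  simp [map_sum, _root_.pd]

theorem sum_rotPairs (F : Fin 4 × Fin 4 → ℝ) : ∑ p ∈ rotPairs, F p =
    F (0, 1) + F (0, 2) + F (0, 3) + F (1, 2) + F (1, 3) + F (2, 3) := by
  rw [rotPairs, Finset.sum_filter, Fintype.sum_prod_type]
  simp [Fin.sum_univ_four]
  ring

/-- The Plücker coordinates of the plane spanned by `e` and `v`. -/
noncomputable def plucker (e v : EuclideanSpace ℝ (Fin 4)) (p : Fin 4 × Fin 4) : ℝ :=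
  e p.1 * v p.2 - e p.2 * v p.1

theorem sum_sq_eq_one {e : EuclideanSpace ℝ (Fin 4)} (he : ‖e‖ = 1) :
    e 0 ^ 2 + e 1 ^ 2 + e 2 ^ 2 + e 3 ^ 2 = 1 := by
  have := EuclideanSpace.real_norm_sq_eq e
  rw [he, Fin.sum_univ_four] at this
  linarith

theorem sum_mul_eq_zero {e v : EuclideanSpace ℝ (Fin 4)} (hev : inner ℝ e v = 0) :
    e 0 * v 0 + e 1 * v 1 + e 2 * v 2 + e 3 * v 3 = 0 := by
  rw [PiLp.inner_apply, Fin.sum_univ_four] at hev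
  simp only [RCLike.inner_apply, conj_trivial] at hev
  linarith

theorem sum_plucker_sq {e v : EuclideanSpace ℝ (Fin 4)} (he : ‖e‖ = 1) (hv : ‖v‖ = 1)
    (hev : inner ℝ e v = 0) : ∑ p ∈ rotPairs, plucker e v p ^ 2 = 1 := by
  rw [sum_rotPairs]
  simp only [plucker]
  have h1 := sum_sq_eq_one he
  have h2 := sum_sq_eq_one hv
  have h3 := sum_mul_eq_zero hev
  linear_combination (v 0 ^ 2 + v 1 ^ 2 + v 2 ^ 2 + v 3 ^ 2) * h1 + h2 -
    (e 0 * v 0 + e 1 * v 1 + e 2 * v 2 + e 3 * v 3) * h3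

theorem hasDerivAt_comp_geodesic {g : EuclideanSpace ℝ (Fin 4) → ℝ} (hg : Differentiable ℝ g)
    {e v : EuclideanSpace ℝ (Fin 4)} (he : ‖e‖ = 1) (hv : ‖v‖ = 1) (hev : inner ℝ e v = 0)
    (ρ θ : ℝ) :
    HasDerivAt (fun θ : ℝ => g (ρ • (cos θ • e + sin θ • v)))
      (∑ p ∈ rotPairs, plucker e v p * rot p.1 p.2 g (ρ • (cos θ • e + sin θ • v))) θ := by
  have hγ : HasDerivAt (fun θ : ℝ => ρ • (cos θ • e + sin θ • v))
      (ρ • ((-sin θ) • e + cos θ • v)) θ :=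
    (((hasDerivAt_cos θ).smul_const e).add ((hasDerivAt_sin θ).smul_const v)).const_smul ρ
  convert! (hg _).hasFDerivAt.comp_hasDerivAt θ hγ using 1
  rw [fderiv_apply_eq_sum_pd, sum_rotPairs, Fin.sum_univ_four]
  simp only [plucker, rot]
  generalize pd 0 g _ = d0
  generalize pd 1 g _ = d1
  generalize pd 2 g _ = d2
  generalize pd 3 g _ = d3
  have h1 := sum_sq_eq_one he
  have h2 := sum_sq_eq_one hv
  have h3 := sum_mul_eq_zero hev
  simp only [PiLp.smul_apply, PiLp.add_apply, smul_eq_mul]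
  linear_combination (ρ * cos θ * (d0 * v 0 + d1 * v 1 + d2 * v 2 + d3 * v 3)) * h1 -
    (ρ * sin θ * (d0 * e 0 + d1 * e 1 + d2 * e 2 + d3 * e 3)) * h2 +
    (ρ * sin θ * (d0 * v 0 + d1 * v 1 + d2 * v 2 + d3 * v 3) -
      ρ * cos θ * (d0 * e 0 + d1 * e 1 + d2 * e 2 + d3 * e 3)) * h3

/-- `∑_{|α| ≤ 2} |Ω^α g|²`. -/
noncomputable def rotEnergy (g : EuclideanSpace ℝ (Fin 4) → ℝ) (x : EuclideanSpace ℝ (Fin 4)) : ℝ :=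
  g x ^ 2 + (∑ p ∈ rotPairs, rot p.1 p.2 g x ^ 2) +
    ∑ p ∈ rotPairs, ∑ q ∈ rotPairs, rot q.1 q.2 (rot p.1 p.2 g) x ^ 2

theorem rotEnergy_nonneg (g : EuclideanSpace ℝ (Fin 4) → ℝ) (x : EuclideanSpace ℝ (Fin 4)) :
    0 ≤ rotEnergy g x := by
  unfold rotEnergy; positivity

theorem continuous_rotEnergy {g : EuclideanSpace ℝ (Fin 4) → ℝ} (hg : ContDiff ℝ (⊤ : ℕ∞) g) :
    Continuous (rotEnergy g) := by
  have h0 := hg.continuous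
  have h1 := fun i j => (hg.rot i j).continuous
  have h2 := fun i j k l => ((hg.rot i j).rot k l).continuous
  unfold rotEnergy
  fun_prop

theorem sq_le_integral_rotEnergy {g : EuclideanSpace ℝ (Fin 4) → ℝ} (hg : ContDiff ℝ (⊤ : ℕ∞) g)
    {e v : EuclideanSpace ℝ (Fin 4)} (he : ‖e‖ = 1) (hv : ‖v‖ = 1) (hev : inner ℝ e v = 0) (ρ : ℝ) :
    g (ρ • e) ^ 2 ≤
      84 * ∫ θ in (0 : ℝ)..1, sin θ ^ 2 * rotEnergy g (ρ • (cos θ • e + sin θ • v)) := by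
  let γ : ℝ → EuclideanSpace ℝ (Fin 4) := fun θ => ρ • (cos θ • e + sin θ • v)
  have hγ : Continuous γ := by fun_prop
  have hd : ∀ {f : EuclideanSpace ℝ (Fin 4) → ℝ}, ContDiff ℝ (⊤ : ℕ∞) f → ∀ θ,
      HasDerivAt (fun θ => f (γ θ)) (∑ p ∈ rotPairs, plucker e v p * rot p.1 p.2 f (γ θ)) θ :=
    fun hf θ => hasDerivAt_comp_geodesic (hf.differentiable (by simp)) he hv hev ρ θ
  have hE := (continuous_rotEnergy hg).comp hγ
  have h2 := fun i j k l => (((hg.rot i j).rot k l).continuous).comp hγ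
  have hcs : ∀ F : Fin 4 × Fin 4 → ℝ,
      (∑ p ∈ rotPairs, plucker e v p * F p) ^ 2 ≤ ∑ p ∈ rotPairs, F p ^ 2 := fun F => by
    simpa [sum_plucker_sq he hv hev] using
      Finset.sum_mul_sq_le_sq_mul_sq rotPairs (plucker e v) F
  have main := sq_le_integral_weighted_sq_deriv_two (hd hg)
    (fun θ => HasDerivAt.fun_sum fun p _ => (hd (hg.rot p.1 p.2) θ).const_mul (plucker e v p))
    (by simp only [Function.comp_def] at h2; fun_prop)
  have hγ0 : γ 0 = ρ • e := by simp [γ]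
  rw [hγ0] at main
  refine main.trans ?_
  have h1 := fun i j => ((hg.rot i j).continuous).comp hγ
  have h0 := hg.continuous.comp hγ
  simp only [Function.comp_def] at h0 h1 h2 hE
  rw [← intervalIntegral.integral_const_mul, ← intervalIntegral.integral_const_mul]
  refine intervalIntegral.integral_mono_on zero_le_one
    (Continuous.intervalIntegrable (by fun_prop) _ _)
    (Continuous.intervalIntegrable (by fun_prop) _ _) fun θ hθ => ?_
  have hbound : g (γ θ) ^ 2 + (∑ p ∈ rotPairs, plucker e v p * rot p.1 p.2 g (γ θ)) ^ 2 +
      (∑ p ∈ rotPairs, plucker e v p *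
        ∑ q ∈ rotPairs, plucker e v q * rot q.1 q.2 (rot p.1 p.2 g) (γ θ)) ^ 2 ≤
      rotEnergy g (γ θ) :=
    add_le_add (add_le_add le_rfl (hcs _))
      ((hcs _).trans (Finset.sum_le_sum fun p _ => hcs _))
  have hsin : θ ≤ 2 * sin θ := by
    have h1 := mul_le_sin hθ.1 (by linarith [hθ.2, pi_gt_three])
    have h2 : (1 : ℝ) / 2 ≤ 2 / π := by
      rw [div_le_div_iff₀ two_pos pi_pos]; linarith [pi_le_four]
    nlinarith [hθ.1]
  have hsq : θ ^ 2 ≤ 4 * sin θ ^ 2 := by nlinarith [hθ.1]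
  have h3 := mul_le_mul hsq hbound (by positivity) (by positivity)
  change 21 * (θ ^ 2 * _) ≤ 84 * (sin θ ^ 2 * rotEnergy g (γ θ))
  linarith

theorem annL2_nonneg (f : EuclideanSpace ℝ (Fin 4) → ℝ) (a b : ℝ) : 0 ≤ annL2 f a b :=
  Real.sqrt_nonneg _

theorem rotSum2_nonneg (f : EuclideanSpace ℝ (Fin 4) → ℝ) (a b : ℝ) : 0 ≤ rotSum2 f a b :=
  add_nonneg (add_nonneg (annL2_nonneg _ _ _) (Finset.sum_nonneg fun _ _ => annL2_nonneg _ _ _))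
    (Finset.sum_nonneg fun _ _ => Finset.sum_nonneg fun _ _ => annL2_nonneg _ _ _)

theorem sq_annL2 (f : EuclideanSpace ℝ (Fin 4) → ℝ) (a b : ℝ) :
    annL2 f a b ^ 2 = ∫ x in {x : EuclideanSpace ℝ (Fin 4) | a ≤ ‖x‖ ∧ ‖x‖ ≤ b}, f x ^ 2 :=
  Real.sq_sqrt (integral_nonneg fun _ => sq_nonneg _)

theorem isCompact_annulus (a b : ℝ) :
    IsCompact {x : EuclideanSpace ℝ (Fin 4) | a ≤ ‖x‖ ∧ ‖x‖ ≤ b} := by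
  refine (isCompact_closedBall (0 : EuclideanSpace ℝ (Fin 4)) b).of_isClosed_subset ?_ ?_
  · exact (isClosed_le continuous_const continuous_norm).inter
      (isClosed_le continuous_norm continuous_const)
  · exact fun x hx => by simpa using hx.2

theorem integral_rotEnergy_le {g : EuclideanSpace ℝ (Fin 4) → ℝ} (hg : ContDiff ℝ (⊤ : ℕ∞) g)
    (a b : ℝ) :
    ∫ x in {x : EuclideanSpace ℝ (Fin 4) | a ≤ ‖x‖ ∧ ‖x‖ ≤ b}, rotEnergy g x ≤
      rotSum2 g a b ^ 2 := by
  have hint : ∀ {f : EuclideanSpace ℝ (Fin 4) → ℝ}, ContDiff ℝ (⊤ : ℕ∞) f →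
      IntegrableOn (fun x => f x ^ 2) {x : EuclideanSpace ℝ (Fin 4) | a ≤ ‖x‖ ∧ ‖x‖ ≤ b} :=
    fun hf => (hf.continuous.pow 2).continuousOn.integrableOn_compact (isCompact_annulus a b)
  have h1 := integrable_finsetSum rotPairs fun p _ => hint (hg.rot p.1 p.2)
  have h01 : Integrable (fun x => g x ^ 2 + ∑ p ∈ rotPairs, rot p.1 p.2 g x ^ 2)
      (volume.restrict {x : EuclideanSpace ℝ (Fin 4) | a ≤ ‖x‖ ∧ ‖x‖ ≤ b}) := (hint hg).add h1
  have h2 : ∀ p : Fin 4 × Fin 4, _ := fun p => integrable_finsetSum rotPairs fun q _ =>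
    hint ((hg.rot p.1 p.2).rot q.1 q.2)
  have heq : ∫ x in {x : EuclideanSpace ℝ (Fin 4) | a ≤ ‖x‖ ∧ ‖x‖ ≤ b}, rotEnergy g x =
      annL2 g a b ^ 2 + (∑ p ∈ rotPairs, annL2 (rot p.1 p.2 g) a b ^ 2) +
        ∑ p ∈ rotPairs, ∑ q ∈ rotPairs, annL2 (rot q.1 q.2 (rot p.1 p.2 g)) a b ^ 2 := by
    unfold rotEnergy
    rw [integral_add h01 (integrable_finsetSum rotPairs fun p _ => h2 p),
      integral_add (hint hg) h1,
      integral_finsetSum _ fun p _ => hint (hg.rot p.1 p.2),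
      integral_finsetSum _ fun p _ => h2 p]
    simp_rw [sq_annL2]
    congr 1
    refine Finset.sum_congr rfl fun p _ => ?_
    exact integral_finsetSum _ fun q _ => hint ((hg.rot p.1 p.2).rot q.1 q.2)
  rw [heq, rotSum2]
  set A := annL2 g a b
  have hA : 0 ≤ A := annL2_nonneg _ _ _
  have hB := Finset.sum_sq_le_sq_sum_of_nonneg (s := rotPairs)
    (f := fun p => annL2 (rot p.1 p.2 g) a b) fun _ _ => annL2_nonneg _ _ _
  have hB0 : 0 ≤ ∑ p ∈ rotPairs, annL2 (rot p.1 p.2 g) a b :=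
    Finset.sum_nonneg fun _ _ => annL2_nonneg _ _ _
  have hC0 : ∀ p : Fin 4 × Fin 4,
      0 ≤ ∑ q ∈ rotPairs, annL2 (rot q.1 q.2 (rot p.1 p.2 g)) a b := fun p =>
    Finset.sum_nonneg fun _ _ => annL2_nonneg _ _ _
  have hC := (Finset.sum_le_sum fun p (_ : p ∈ rotPairs) =>
      Finset.sum_sq_le_sq_sum_of_nonneg (s := rotPairs)
        (f := fun q => annL2 (rot q.1 q.2 (rot p.1 p.2 g)) a b)
        fun _ _ => annL2_nonneg _ _ _).trans
    (Finset.sum_sq_le_sq_sum_of_nonneg fun p _ => hC0 p)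
  have hC1 := Finset.sum_nonneg fun p (_ : p ∈ rotPairs) => hC0 p
  nlinarith [mul_nonneg hA hB0, mul_nonneg hA hC1, mul_nonneg hB0 hC1]

theorem norm_geodesic {e v : EuclideanSpace ℝ (Fin 4)} (he : ‖e‖ = 1) (hv : ‖v‖ = 1)
    (hev : inner ℝ e v = 0) {ρ : ℝ} (hρ : 0 ≤ ρ) (θ : ℝ) :
    ‖ρ • (cos θ • e + sin θ • v)‖ = ρ := by
  have h : ‖cos θ • e + sin θ • v‖ ^ 2 = 1 := by
    rw [norm_add_sq_real, norm_smul, norm_smul, inner_smul_left, inner_smul_right, he, hv, hev]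
    simp
  rw [norm_smul, (pow_eq_one_iff_of_nonneg (norm_nonneg _) two_ne_zero).1 h, mul_one,
    Real.norm_of_nonneg hρ]

theorem pow_three_mul_integral_ray_le_setLIntegral {g : EuclideanSpace ℝ (Fin 4) → ℝ}
    (hg : ContDiff ℝ (⊤ : ℕ∞) g) {e v : EuclideanSpace ℝ (Fin 4)} (he : ‖e‖ = 1) (hv : ‖v‖ = 1)
    (hev : inner ℝ e v = 0) {R : ℝ} (hR : 0 < R) {F : EuclideanSpace ℝ (Fin 4) → ℝ≥0∞}
    (hF : ∀ x, R ≤ ‖x‖ → ‖x‖ ≤ R + 2 → ENNReal.ofReal (rotEnergy g x) ≤ F x) :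
    ENNReal.ofReal (R ^ 3 * ∫ ρ in R..R + 2, g (ρ • e) ^ 2) ≤
      84 * ∫⁻ p in Ioi (0 : ℝ) ×ˢ Ioo 0 π, ENNReal.ofReal (p.1 ^ 3 * sin p.2 ^ 2) *
        F (p.1 • (cos p.2 • e + sin p.2 • v)) := by
  let Φ : ℝ × ℝ → ℝ := fun p =>
    84 * (p.1 ^ 3 * sin p.2 ^ 2 * rotEnergy g (p.1 • (cos p.2 • e + sin p.2 • v)))
  have hE := continuous_rotEnergy hg
  have hg0 := hg.continuous
  have hΦ : Continuous Φ := by fun_prop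
  have hRle : R ≤ R + 2 := by linarith
  have hΦ0 : ∀ {ρ : ℝ}, 0 ≤ ρ → ∀ θ, 0 ≤ Φ (ρ, θ) := fun hρ θ =>
    mul_nonneg (by norm_num) (mul_nonneg (by positivity) (rotEnergy_nonneg _ _))
  calc ENNReal.ofReal (R ^ 3 * ∫ ρ in R..R + 2, g (ρ • e) ^ 2)
      = ∫⁻ ρ in Ioc R (R + 2), ENNReal.ofReal (R ^ 3 * g (ρ • e) ^ 2) := by
        rw [← intervalIntegral.integral_const_mul, intervalIntegral.integral_of_le hRle,
          ofReal_integral_eq_lintegral_ofReal]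
        · exact (Continuous.intervalIntegrable (by fun_prop) R (R + 2)).1
        · exact ae_of_all _ fun ρ => by positivity
    _ ≤ ∫⁻ ρ in Ioc R (R + 2), ∫⁻ θ in Ioo (0 : ℝ) 1, ENNReal.ofReal (Φ (ρ, θ)) := by
        refine setLIntegral_mono' measurableSet_Ioc fun ρ hρ => ?_
        have hρ0 : 0 ≤ ρ := hR.le.trans hρ.1.le
        rw [restrict_Ioo_eq_restrict_Ioc, ← ofReal_integral_eq_lintegral_ofReal
          (Continuous.intervalIntegrable (by fun_prop) 0 1).1 (ae_of_all _ fun θ => hΦ0 hρ0 θ),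
          ← intervalIntegral.integral_of_le zero_le_one]
        refine ENNReal.ofReal_le_ofReal ?_
        have h1 : R ^ 3 ≤ ρ ^ 3 := pow_le_pow_left₀ hR.le hρ.1.le 3
        refine (mul_le_mul h1 (sq_le_integral_rotEnergy hg he hv hev ρ) (sq_nonneg _)
          (by positivity)).trans_eq ?_
        rw [mul_left_comm, ← intervalIntegral.integral_const_mul,
          ← intervalIntegral.integral_const_mul]
        refine intervalIntegral.integral_congr fun θ _ => ?_
        simp only [Φ]
        ring
    _ = ∫⁻ p in Ioc R (R + 2) ×ˢ Ioo (0 : ℝ) 1, ENNReal.ofReal (Φ p) := by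
        rw [Measure.volume_eq_prod, ← Measure.prod_restrict, lintegral_prod _ (by fun_prop)]
    _ ≤ ∫⁻ p in Ioc R (R + 2) ×ˢ Ioo (0 : ℝ) 1, 84 * (ENNReal.ofReal (p.1 ^ 3 * sin p.2 ^ 2) *
          F (p.1 • (cos p.2 • e + sin p.2 • v))) := by
        refine setLIntegral_mono' (measurableSet_Ioc.prod measurableSet_Ioo) ?_
        rintro ⟨ρ, θ⟩ ⟨hρ, -⟩
        have hρ0 : 0 ≤ ρ := hR.le.trans hρ.1.le
        have hn := norm_geodesic he hv hev hρ0 θ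
        simp only [Φ]
        rw [ENNReal.ofReal_mul (by norm_num), ENNReal.ofReal_mul (by positivity),
          ENNReal.ofReal_ofNat]
        gcongr
        exact hF _ (hρ.1.le.trans_eq hn.symm) (hn.trans_le hρ.2)
    _ ≤ ∫⁻ p in Ioi (0 : ℝ) ×ˢ Ioo 0 π, 84 * (ENNReal.ofReal (p.1 ^ 3 * sin p.2 ^ 2) *
          F (p.1 • (cos p.2 • e + sin p.2 • v))) :=
        lintegral_mono_set (prod_mono (fun ρ hρ => hR.trans hρ.1)
          (Ioo_subset_Ioo_right (by linarith [pi_gt_three])))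
    _ = _ := lintegral_const_mul' _ _ (by norm_num)

theorem exists_integral_ray_sq_le : ∃ C > (0 : ℝ), ∀ g : EuclideanSpace ℝ (Fin 4) → ℝ,
    ContDiff ℝ (⊤ : ℕ∞) g → ∀ e : EuclideanSpace ℝ (Fin 4), ‖e‖ = 1 → ∀ R : ℝ, 0 < R →
      R ^ 3 * ∫ ρ in R..R + 2, g (ρ • e) ^ 2 ≤ C * rotSum2 g (R - 1) (R + 2) ^ 2 := by
  let σ : Measure (sphere (0 : EuclideanSpace ℝ (Fin 3)) 1) := Measure.toSphere volume
  have hσ : σ univ ≠ 0 := Measure.measure_univ_ne_zero.2 (Measure.toSphere_ne_zero _)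
  have hσ0 : 0 < (σ univ).toReal := ENNReal.toReal_pos hσ (measure_ne_top _ _)
  refine ⟨84 / (σ univ).toReal, by positivity, fun g hg e he R hR => ?_⟩
  obtain ⟨L, hL, hpolar⟩ := setLIntegral_geodesic_polar he
  let S := {x : EuclideanSpace ℝ (Fin 4) | R - 1 ≤ ‖x‖ ∧ ‖x‖ ≤ R + 2}
  have hS : IsCompact S := isCompact_annulus _ _
  have hE := continuous_rotEnergy hg
  let F : EuclideanSpace ℝ (Fin 4) → ℝ≥0∞ := S.indicator fun x => ENNReal.ofReal (rotEnergy g x)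
  have hFm : Measurable F := Measurable.indicator (by fun_prop) hS.measurableSet
  have hFE : ∀ x, R ≤ ‖x‖ → ‖x‖ ≤ R + 2 → ENNReal.ofReal (rotEnergy g x) ≤ F x := fun x h1 h2 => by
    rw [show F x = _ from indicator_of_mem (show x ∈ S from ⟨by linarith, h2⟩) _]
  have hFint : ∫⁻ x, F x = ENNReal.ofReal (∫ x in S, rotEnergy g x) := by
    rw [lintegral_indicator hS.measurableSet, ofReal_integral_eq_lintegral_ofReal
      (hE.continuousOn.integrableOn_compact hS) (ae_of_all _ fun x => rotEnergy_nonneg g x)]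
  set I := R ^ 3 * ∫ ρ in R..R + 2, g (ρ • e) ^ 2
  have hE0 : 0 ≤ ∫ x in S, rotEnergy g x := integral_nonneg fun x => rotEnergy_nonneg g x
  have key : ENNReal.ofReal (I * (σ univ).toReal) ≤
      ENNReal.ofReal (84 * ∫ x in S, rotEnergy g x) := by
    rw [ENNReal.ofReal_mul' hσ0.le, ENNReal.ofReal_toReal (measure_ne_top _ _),
      ENNReal.ofReal_mul (p := 84) (by norm_num), ← hFint, ENNReal.ofReal_ofNat, ← lintegral_const]
    refine le_trans ?_ (mul_le_mul_right (hpolar F hFm) 84)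
    rw [← lintegral_const_mul' _ _ (by norm_num)]
    refine lintegral_mono fun ω => ?_
    exact pow_three_mul_integral_ray_le_setLIntegral hg he (by simp) (hL _) hR hFE
  have hfin := (ENNReal.ofReal_le_ofReal_iff (by positivity)).1 key
  rw [div_mul_eq_mul_div, le_div_iff₀ hσ0]
  exact hfin.trans (by gcongr; exact integral_rotEnergy_le hg _ _)

theorem sq_le_integral_ray {h : EuclideanSpace ℝ (Fin 4) → ℝ} (hh : ContDiff ℝ (⊤ : ℕ∞) h)
    {e : EuclideanSpace ℝ (Fin 4)} (he : ‖e‖ = 1) {R r : ℝ} (hR : R ≤ r) (hr : r ≤ R + 1) :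
    h (r • e) ^ 2 ≤ 2 * ((∫ ρ in R..R + 2, h (ρ • e) ^ 2) +
      ∑ k, ∫ ρ in R..R + 2, pd k h (ρ • e) ^ 2) := by
  have h0 := hh.continuous
  have h1 := fun k => (hh.pd k).continuous
  have hd : ∀ t : ℝ, HasDerivAt (fun t : ℝ => h ((r + t) • e)) (∑ k, e k * pd k h ((r + t) • e)) t :=
    fun t => by
      have hγ : HasDerivAt (fun t : ℝ => (r + t) • e) e t := by
        simpa using ((hasDerivAt_id t).const_add r).smul_const e
      rw [← fderiv_apply_eq_sum_pd]
      exact ((hh.differentiable (by simp)) _).hasFDerivAt.comp_hasDerivAt t hγ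
  have main := sq_le_integral_sq_add_sq_deriv hd (by fun_prop)
  rw [add_zero] at main
  refine main.trans (mul_le_mul_of_nonneg_left ?_ zero_le_two)
  have hcs : ∀ x, (∑ k, e k * pd k h x) ^ 2 ≤ ∑ k, pd k h x ^ 2 := fun x => by
    have h2 := Finset.sum_mul_sq_le_sq_mul_sq Finset.univ (fun k => e k) (fun k => pd k h x)
    rwa [← EuclideanSpace.real_norm_sq_eq, he, one_pow, one_mul] at h2
  have hc : Continuous fun ρ : ℝ => h (ρ • e) ^ 2 + ∑ k, pd k h (ρ • e) ^ 2 := by fun_prop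
  calc ∫ t in (0 : ℝ)..1, (h ((r + t) • e) ^ 2 + (∑ k, e k * pd k h ((r + t) • e)) ^ 2)
      ≤ ∫ t in (0 : ℝ)..1, (h ((r + t) • e) ^ 2 + ∑ k, pd k h ((r + t) • e) ^ 2) :=
        intervalIntegral.integral_mono_on zero_le_one
          (Continuous.intervalIntegrable (by fun_prop) _ _)
          (Continuous.intervalIntegrable (by fun_prop) _ _)
          fun t _ => add_le_add le_rfl (hcs _)
    _ = ∫ ρ in r..r + 1, (h (ρ • e) ^ 2 + ∑ k, pd k h (ρ • e) ^ 2) := by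
        simpa using intervalIntegral.integral_comp_add_left (a := 0) (b := 1)
          (fun ρ : ℝ => h (ρ • e) ^ 2 + ∑ k, pd k h (ρ • e) ^ 2) r
    _ ≤ ∫ ρ in R..R + 2, (h (ρ • e) ^ 2 + ∑ k, pd k h (ρ • e) ^ 2) :=
        intervalIntegral.integral_mono_interval hR (by linarith) (by linarith)
          (ae_of_all _ fun ρ => by positivity) (hc.intervalIntegrable _ _)
    _ = _ := by
        rw [intervalIntegral.integral_add, intervalIntegral.integral_finsetSum]
        all_goals intros; exact Continuous.intervalIntegrable (by fun_prop) _ _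

/-- there is an absolute constant `C > 0` such that for every
`h ∈ C^∞(ℝ⁴)` and `R > 1`,
`‖h‖_{L^∞(R ≤ |x| ≤ R+1)} ≤ C R^{-3/2} Σ_{|α|≤2, j≤1} ‖Ω^α ∇^j h‖_{L²(R-1 ≤ |x| ≤ R+2)}`. -/
theorem annulus_sup_bound :
    ∃ C > (0:ℝ), ∀ h : EuclideanSpace ℝ (Fin 4) → ℝ, ContDiff ℝ (⊤ : ℕ∞) h →
      ∀ R : ℝ, 1 < R →
      (⨆ x ∈ {x : EuclideanSpace ℝ (Fin 4) | R ≤ ‖x‖ ∧ ‖x‖ ≤ R + 1}, |h x|) ≤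
        C * R ^ (-(3:ℝ)/2) *
          (rotSum2 h (R - 1) (R + 2) + ∑ k : Fin 4, rotSum2 (pd k h) (R - 1) (R + 2)) := by
  obtain ⟨C, hC, hray⟩ := exists_integral_ray_sq_le
  refine ⟨√(2 * C), by positivity, fun h hh R hR => ?_⟩
  have hR0 : 0 < R := by linarith
  set A := rotSum2 h (R - 1) (R + 2)
  set B : Fin 4 → ℝ := fun k => rotSum2 (pd k h) (R - 1) (R + 2)
  have hA0 : 0 ≤ A := rotSum2_nonneg _ _ _
  have hB0 : ∀ k, 0 ≤ B k := fun k => rotSum2_nonneg _ _ _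
  have hBs : 0 ≤ ∑ k, B k := Finset.sum_nonneg fun k _ => hB0 k
  have hbd : 0 ≤ √(2 * C) * R ^ (-(3 : ℝ) / 2) * (A + ∑ k, B k) := by positivity
  refine Real.iSup_le (fun x => Real.iSup_le (fun hx => ?_) hbd) hbd
  have hx0 : 0 < ‖x‖ := hR0.trans_le hx.1
  have he : ‖‖x‖⁻¹ • x‖ = 1 := by
    rw [norm_smul, norm_inv, norm_norm, inv_mul_cancel₀ hx0.ne']
  have hpt := sq_le_integral_ray hh he hx.1 hx.2
  rw [smul_inv_smul₀ hx0.ne'] at hpt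
  have hsum : R ^ 3 * h x ^ 2 ≤ 2 * C * (A ^ 2 + ∑ k, B k ^ 2) := by
    have h1 := hray h hh _ he R hR0
    have h2 := Finset.sum_le_sum fun k (_ : k ∈ Finset.univ) => hray _ (hh.pd k) _ he R hR0
    rw [← Finset.mul_sum, ← Finset.mul_sum] at h2
    have h3 := mul_le_mul_of_nonneg_left hpt (pow_nonneg hR0.le 3)
    linarith
  have hsq : A ^ 2 + ∑ k, B k ^ 2 ≤ (A + ∑ k, B k) ^ 2 := by
    have := Finset.sum_sq_le_sq_sum_of_nonneg (s := Finset.univ) fun k _ => hB0 k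
    nlinarith [mul_nonneg hA0 hBs]
  have hRpow : (R ^ (-(3 : ℝ) / 2)) ^ 2 * R ^ 3 = 1 := by
    rw [← Real.rpow_natCast, ← Real.rpow_natCast, ← Real.rpow_mul hR0.le, ← Real.rpow_add hR0]
    norm_num
  refine abs_le_of_sq_le_sq ?_ hbd
  rw [mul_pow, mul_pow, Real.sq_sqrt (by positivity)]
  calc h x ^ 2 = (R ^ (-(3 : ℝ) / 2)) ^ 2 * (R ^ 3 * h x ^ 2) := by
        rw [← mul_assoc, hRpow, one_mul]
    _ ≤ (R ^ (-(3 : ℝ) / 2)) ^ 2 * (2 * C * (A + ∑ k, B k) ^ 2) := by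
        exact mul_le_mul_of_nonneg_left (hsum.trans (by gcongr)) (sq_nonneg _)
    _ = _ := by ring
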